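/- arXiv:2303.06862 — 2 statements merged into one kernel-verified Lean document; each statement's English description precedes it below -/
import Mathlib

section
/- Under the DHSPG single-group setup with the quadratic h and threshold λ̂, suppose 0 < α ≤ 1/L and cos θ < 0. Then λ̂ ≥ λ_min, with strict inequality λ̂ > λ_min whenever cos θ > −1. -/
open scoped RealInnerProductSpace

/-- for `0 < α ≤ 1/L` and `cos θ < 0`, the threshold satisfies
`λ̂ ≥ λ_min`, strictly whenever `cos θ > −1`. -/
theorem dhspg_lamHat_ge_lamMin {H : Type*} [NormedAddCommGroup H] [InnerProductSpace ℝ H]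
    (u v : H) (hu : u ≠ 0) (hv : v ≠ 0)
    (cosθ : ℝ) (hcos : cosθ = ⟪v, u⟫ / (‖v‖ * ‖u‖))
    (L α : ℝ) (hL : 0 < L) (hα : 0 < α) (hαL : α ≤ 1 / L)
    (hneg : cosθ < 0)
    (lamMin : ℝ) (hlamMin : lamMin = -cosθ * ‖u‖)
    (lamHat : ℝ)
    (hlamHat : lamHat = ((1 - L * α) * α * cosθ * ‖u‖
        + Real.sqrt ((1 - L * α) ^ 2 * α ^ 2 * cosθ ^ 2 * ‖u‖ ^ 2
            + 2 * L * α ^ 2 * (α - L * α ^ 2 / 2) * ‖u‖ ^ 2)) / (L * α ^ 2)) :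
    lamMin ≤ lamHat ∧ (-1 < cosθ → lamMin < lamHat) := by
  have hn : 0 < ‖u‖ := norm_pos_iff.mpr hu
  have hc : -1 ≤ cosθ := by
    rw [hcos]
    exact (abs_le.mp (abs_real_inner_div_norm_mul_norm_le_one v u)).1
  have ht : L * α ≤ 1 := by
    rw [mul_comm]
    exact (le_div_iff₀ hL).mp hαL
  have hden : 0 < L * α ^ 2 := by positivity
  set D := (1 - L * α) ^ 2 * α ^ 2 * cosθ ^ 2 * ‖u‖ ^ 2
    + 2 * L * α ^ 2 * (α - L * α ^ 2 / 2) * ‖u‖ ^ 2 with hD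
  have hK : 0 < α ^ 2 * ‖u‖ ^ 2 * (L * α * (2 - L * α)) * (1 - cosθ) := by
    have : 0 < 2 - L * α := by linarith
    have : 0 < 1 - cosθ := by linarith
    positivity
  have hgap : D = (-cosθ * ‖u‖ * α) ^ 2
      + α ^ 2 * ‖u‖ ^ 2 * (L * α * (2 - L * α)) * (1 - cosθ) * (1 + cosθ) := by
    rw [hD]
    ring
  have hroot : 0 ≤ -cosθ * ‖u‖ * α := by
    have : 0 < -cosθ := by linarith
    positivity
  rw [hlamMin, hlamHat]
  constructor
  · rw [le_div_iff₀ hden]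
    have h : -cosθ * ‖u‖ * α ≤ √D := by
      apply Real.le_sqrt_of_sq_le
      rw [hgap]
      exact le_add_of_nonneg_right (mul_nonneg hK.le (by linarith))
    linarith
  · intro hc'
    rw [lt_div_iff₀ hden]
    have h : -cosθ * ‖u‖ * α < √D := by
      rw [Real.lt_sqrt hroot, hgap]
      exact lt_add_of_pos_right _ (mul_pos hK (by linarith))
    linarith
end

section
/- Under the DHSPG single-group setup, suppose λ > λ_min, so that B := ⟨v, u⟩ + λ‖v‖ = ⟨v, −d⟩ > 0 (and hence d ≠ 0). Then for every step size α with 0 < α < 2B/‖d‖², the variable magnitude strictly decreases: ‖v + α d‖ < ‖v‖. -/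
open scoped RealInnerProductSpace

/-- if `λ > λ_min` then `B := ⟪v, u⟫ + λ‖v‖ = ⟪v, −d⟫ > 0` (hence `d ≠ 0`),
and for every step size `0 < α < 2B/‖d‖²` the magnitude strictly decreases:
`‖v + α d‖ < ‖v‖`. -/
theorem dhspg_magnitude_decrease {H : Type*} [NormedAddCommGroup H]
    [InnerProductSpace ℝ H]
    (u v : H) (hu : u ≠ 0) (hv : v ≠ 0)
    (cosθ : ℝ) (hcos : cosθ = ⟪v, u⟫ / (‖v‖ * ‖u‖))
    (lamMin : ℝ) (hlamMin : lamMin = -cosθ * ‖u‖)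
    (lam : ℝ) (hlam : 0 < lam) (hlam' : lamMin < lam)
    (d : H) (hd : d = -u - (lam / ‖v‖) • v)
    (B : ℝ) (hB : B = ⟪v, u⟫ + lam * ‖v‖) :
    B = ⟪v, -d⟫ ∧ 0 < B ∧ d ≠ 0 ∧
      ∀ α : ℝ, 0 < α → α < 2 * B / ‖d‖ ^ 2 → ‖v + α • d‖ < ‖v‖ := by
  have hv' : 0 < ‖v‖ := norm_pos_iff.mpr hv
  have hu' : 0 < ‖u‖ := norm_pos_iff.mpr hu
  have hBd : B = ⟪v, -d⟫ := by
    rw [hB, hd, neg_sub, sub_neg_eq_add, inner_add_right, inner_smul_right,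
      real_inner_self_eq_norm_sq]
    field_simp
    ring
  have hinner : cosθ * ‖u‖ * ‖v‖ = ⟪v, u⟫ := by
    rw [hcos]
    field_simp
  have hBpos : 0 < B := by
    have h : 0 < (lam + cosθ * ‖u‖) * ‖v‖ := mul_pos (by linarith) hv'
    linarith
  have hd0 : d ≠ 0 := by
    rintro rfl
    simp [hBd] at hBpos
  refine ⟨hBd, hBpos, hd0, fun α hα hαB => ?_⟩
  have hd' : 0 < ‖d‖ ^ 2 := pow_pos (norm_pos_iff.mpr hd0) 2
  rw [lt_div_iff₀ hd'] at hαB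
  rw [inner_neg_right] at hBd
  refine lt_of_pow_lt_pow_left₀ 2 hv'.le ?_
  rw [norm_add_sq_real, inner_smul_right, norm_smul, mul_pow, Real.norm_eq_abs, sq_abs]
  have h := mul_pos hα (sub_pos.mpr hαB)
  rw [hBd] at h
  linarith
end
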